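/- Let (Σ_m, σ) be the full shift, r ≥ 1, and Φ(x^{(1)},…,x^{(r)}) = φ_1(x^{(1)}_1) ⋯ φ_r(x^{(r)}_1) where each φ_k : {0,…,m−1} → ℝ and x^{(i)}_1 denotes the first coordinate of x^{(i)}. For a probability vector p = (p_0,…,p_{m−1}) with Bernoulli measure μ_p, one has A(p) := ∫_{Σ_m^r} Φ d(μ_p)^{⊗r} = Π_{k=1}^r Σ_{j=0}^{m−1} φ_k(j) p_j; moreover, for every α with E_Φ(α) ≠ ∅, h_top(E_Φ(α)) = max{ H_1(p) : p a probability vector with A(p) = α }, where H_1(p) = −Σ_{j=0}^{m−1} p_j log p_j. -/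

import Mathlib

open MeasureTheory Filter Topology
open scoped ENNReal NNReal

section Defs

variable {X : Type*} [MetricSpace X]

/-- The Bowen ball `B_n(x, ε)` for the dynamics `T`. -/
def bowenBall (T : X → X) (n : ℕ) (ε : ℝ) (x : X) : Set X :=
  {y | ∀ j < n, dist (T^[j] x) (T^[j] y) < ε}

/-- `H^s_n(Z, ε)`: infimum of `∑ exp(-s n_i)` over countable covers of `Z` by Bowen balls
`B_{n_i}(x_i, ε)` with `n_i ≥ n`. -/
noncomputable def bowenHn (T : X → X) (Z : Set X) (s ε : ℝ) (n : ℕ) : ℝ≥0∞ :=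
  ⨅ (c : ℕ → X × ℕ) (_ : Z ⊆ ⋃ i, bowenBall T (c i).2 ε (c i).1) (_ : ∀ i, n ≤ (c i).2),
    ∑' i, ENNReal.ofReal (Real.exp (-(s * ((c i).2 : ℝ))))

/-- `H^s(Z, ε) = lim_n H^s_n(Z, ε)` (the quantities are nondecreasing in `n`). -/
noncomputable def bowenH (T : X → X) (Z : Set X) (s ε : ℝ) : ℝ≥0∞ :=
  ⨆ n : ℕ, bowenHn T Z s ε n

/-- `h_top(Z, ε)`: the critical value of `s ↦ H^s(Z, ε)`. -/
noncomputable def bowenEnt (T : X → X) (Z : Set X) (ε : ℝ) : ℝ≥0∞ :=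
  ⨅ (s : ℝ≥0) (_ : bowenH T Z s ε = 0), (s : ℝ≥0∞)

/-- Bowen's topological entropy of an arbitrary subset `Z ⊆ X`:
`h_top(Z) = lim_{ε → 0} h_top(Z, ε)`. -/
noncomputable def htop (T : X → X) (Z : Set X) : ℝ≥0∞ :=
  ⨆ (ε : ℝ) (_ : 0 < ε), bowenEnt T Z ε

variable [MeasurableSpace X]

/-- Shannon entropy of the finite measurable partition of `X` induced by `P : X → ι`. -/
noncomputable def partEntropy {ι : Type} [Fintype ι] (μ : Measure X) (P : X → ι) : ℝ :=
  ∑ i : ι, Real.negMulLog ((μ (P ⁻¹' {i})).toReal)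

/-- The measure-theoretic (Kolmogorov–Sinai) entropy `h_μ(T)`: supremum over finite measurable
partitions `P` of `lim_n (1/n) H_μ(P ∨ T⁻¹P ∨ ⋯ ∨ T^{-(n-1)}P)`, the limit being the
infimum by subadditivity. -/
noncomputable def hKS (T : X → X) (μ : Measure X) : ℝ≥0∞ :=
  ⨆ (k : ℕ) (P : X → Fin k) (_ : Measurable P),
    ENNReal.ofReal (⨅ n : ℕ,
      partEntropy μ (fun x => fun j : Fin (n + 1) => P (T^[(j : ℕ)] x)) / (n + 1))

/-- The V-statistics `V_Φ(n, x) = n^{-r} ∑_{1 ≤ i_1, …, i_r ≤ n} Φ(T^{i_1}x, …, T^{i_r}x)`. -/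
noncomputable def Vstat {r : ℕ} (T : X → X) (Φ : (Fin r → X) → ℝ) (n : ℕ) (x : X) : ℝ :=
  (∑ i : Fin r → Fin n, Φ (fun j => T^[(i j : ℕ) + 1] x)) / (n : ℝ) ^ r

/-- The level set `E_Φ(α) = {x : lim_n V_Φ(n,x) = α}`. -/
def Eset {r : ℕ} (T : X → X) (Φ : (Fin r → X) → ℝ) (α : ℝ) : Set X :=
  {x | Tendsto (fun n => Vstat T Φ n x) atTop (𝓝 α)}

/-- The fiber `M_Φ(α)`: the `T`-invariant Borel probability measures `μ` with
`∫_{X^r} Φ dμ^{⊗r} = α`. -/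
def Mset {r : ℕ} (T : X → X) (Φ : (Fin r → X) → ℝ) (α : ℝ) : Set (Measure X) :=
  {μ | IsProbabilityMeasure μ ∧ MeasurePreserving T μ μ ∧
    ∫ y, Φ y ∂(Measure.pi fun _ : Fin r => μ) = α}

end Defs

section Shift

/- The metric `d(x,y) = (1/2)^{min {n : x_n ≠ y_n}}` on the symbolic space
`Σ_m = {0, …, m-1}^ℕ`; its topology is the product topology. -/
attribute [local instance] PiNat.metricSpace

/-- The shift map `σ` on `Σ_m = {0, …, m-1}^ℕ`. -/
def shift (m : ℕ) : (ℕ → Fin m) → (ℕ → Fin m) := fun x n => x (n + 1)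

/-- The cylinder set `[w] = [a_1, …, a_n]` of sequences starting with the word `w`. -/
def cyl {m : ℕ} (w : List (Fin m)) : Set (ℕ → Fin m) :=
  {x | ∀ i : ℕ, ∀ h : i < w.length, x i = w.get ⟨i, h⟩}

/-- A shift-invariant measure `μ` on `Σ_m` is an `s`-step Markov measure if the conditional
distribution of each coordinate given the past depends only on the preceding `s`
coordinates: for every word `u` of length at least `s` and every letter `a`,
`μ[ua] ⬝ μ[last s letters of u] = μ[u] ⬝ μ[(last s letters of u)a]`. -/
def IsMarkovOfStep {m : ℕ} (s : ℕ) (μ : Measure (ℕ → Fin m)) : Prop :=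
  MeasurePreserving (shift m) μ μ ∧
  ∀ (u : List (Fin m)) (a : Fin m), s ≤ u.length →
    μ (cyl (u ++ [a])) * μ (cyl (u.drop (u.length - s))) =
      μ (cyl u) * μ (cyl (u.drop (u.length - s) ++ [a]))

/-- Empirical frequencies of a finite word. -/
noncomputable def wfreq {m n : ℕ} (u : Fin n → Fin m) (j : Fin m) : ℝ :=
  ((Finset.univ.filter (fun i => u i = j)).card : ℝ) / n

lemma wfreq_nonneg {m n : ℕ} (u : Fin n → Fin m) (j : Fin m) : 0 ≤ wfreq u j := by
  unfold wfreq; positivity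

lemma sum_comp_eq_card {m n : ℕ} (u : Fin n → Fin m) (f : Fin m → ℝ) :
    ∑ i, f (u i) = ∑ j, f j * ((Finset.univ.filter (fun i => u i = j)).card : ℝ) := by
  rw [← Finset.sum_fiberwise (s := Finset.univ) (g := u) (f := fun i => f (u i))]
  refine Finset.sum_congr rfl fun j _ => ?_
  rw [Finset.sum_congr rfl (g := fun _ => f j)]
  · simp [mul_comm]
  · intro i hi
    rw [(Finset.mem_filter.1 hi).2]

lemma sum_comp_div {m n : ℕ} (u : Fin n → Fin m) (f : Fin m → ℝ) :
    (∑ i, f (u i)) / n = ∑ j, f j * wfreq u j := by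
  rw [sum_comp_eq_card, Finset.sum_div]
  exact Finset.sum_congr rfl fun j _ => by rw [wfreq, mul_div_assoc]

lemma wfreq_sum {m n : ℕ} (hn : n ≠ 0) (u : Fin n → Fin m) : ∑ j, wfreq u j = 1 := by
  have := sum_comp_div u (fun _ => 1)
  simp only [one_mul] at this
  rw [← this]
  have : (n : ℝ) ≠ 0 := by exact_mod_cast hn
  simp [this]

lemma wfreq_pow_sum {m n : ℕ} (u : Fin n → Fin m) :
    ∑ v : Fin n → Fin m, ∏ i, wfreq u (v i) = 1 := by
  rw [← Fintype.piFinset_univ, ← Finset.prod_univ_sum (fun _ : Fin n => (Finset.univ : Finset (Fin m)))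
    (fun _ j => wfreq u j)]
  rcases Nat.eq_zero_or_pos n with rfl | h
  · simp
  · simp [wfreq_sum h.ne']

lemma wfreq_weight {m n : ℕ} (u v : Fin n → Fin m)
    (h : wfreq v = wfreq u) :
    ∏ i, wfreq u (v i) = Real.exp (-(n * ∑ j, Real.negMulLog (wfreq u j))) := by
  have hpos : ∀ i, 0 < wfreq u (v i) := by
    intro i
    rw [← h]
    have hn : 0 < n := i.pos
    have : 0 < (Finset.univ.filter (fun k => v k = v i)).card :=
      Finset.card_pos.2 ⟨i, by simp⟩
    unfold wfreq
    positivity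
  rw [← Finset.prod_congr rfl (fun i _ => Real.exp_log (hpos i)), ← Real.exp_sum]
  congr 1
  rcases Nat.eq_zero_or_pos n with rfl | hn
  · simp
  have hn' : (n : ℝ) ≠ 0 := by exact_mod_cast hn.ne'
  have := sum_comp_div v (fun j => Real.log (wfreq u j))
  rw [div_eq_iff hn'] at this
  rw [this, h]
  simp only [Real.negMulLog, neg_mul, Finset.sum_neg_distrib, mul_neg, neg_neg]
  rw [mul_comm]
  congr 1
  exact Finset.sum_congr rfl fun j _ => mul_comm _ _

/-- The number of words with small empirical entropy. -/
lemma card_words_le {m n : ℕ} (h : ℝ) :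
    (Fintype.card {u : Fin n → Fin m // ∑ j, Real.negMulLog (wfreq u j) ≤ h} : ℝ) ≤
      ((n : ℝ) + 1) ^ m * Real.exp (n * h) := by
  classical
  rw [Fintype.card_subtype]
  set S := Finset.univ.filter (fun u : Fin n → Fin m => ∑ j, Real.negMulLog (wfreq u j) ≤ h)
  let c : (Fin n → Fin m) → (Fin m → Fin (n + 1)) := fun u j =>
    ⟨(Finset.univ.filter (fun i => u i = j)).card,
      Nat.lt_succ_of_le ((Finset.card_le_univ _).trans (by simp))⟩
  have hc : ∀ u v, c u = c v → wfreq u = wfreq v := by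
    intro u v huv
    funext j
    have := congrArg Fin.val (congrFun huv j)
    simp only [c] at this
    simp only [wfreq, this]
  have hcard : S.card = ∑ t : Fin m → Fin (n + 1), (S.filter (fun u => c u = t)).card :=
    Finset.card_eq_sum_card_fiberwise (by intro x _; simp)
  rw [hcard]
  push_cast
  have key : ∀ t : Fin m → Fin (n + 1),
      ((S.filter (fun u => c u = t)).card : ℝ) ≤ Real.exp (n * h) := by
    intro t
    rcases (S.filter (fun u => c u = t)).eq_empty_or_nonempty with he | ⟨u, hu⟩
    · rw [he]; simp; positivity
    · rw [Finset.mem_filter] at hu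
      have huh : ∑ j, Real.negMulLog (wfreq u j) ≤ h := (Finset.mem_filter.1 hu.1).2
      have h1 : ∑ v ∈ S.filter (fun u => c u = t), ∏ i, wfreq u (v i) ≤ 1 := by
        rw [← wfreq_pow_sum u]
        exact Finset.sum_le_sum_of_subset_of_nonneg (Finset.subset_univ _)
          fun v _ _ => Finset.prod_nonneg fun i _ => wfreq_nonneg _ _
      have h2 : ((S.filter (fun u => c u = t)).card : ℝ) * Real.exp (-(n * h)) ≤
          ∑ v ∈ S.filter (fun u => c u = t), ∏ i, wfreq u (v i) := by
        rw [← nsmul_eq_mul]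
        refine Finset.card_nsmul_le_sum _ _ _ fun v hv => ?_
        rw [wfreq_weight u v (hc _ _ ((Finset.mem_filter.1 hv).2.trans hu.2.symm))]
        gcongr
      have h3 := h2.trans h1
      rw [Real.exp_neg, ← div_eq_mul_inv, div_le_one (Real.exp_pos _)] at h3
      exact h3
  calc _ ≤ ∑ t : Fin m → Fin (n + 1), Real.exp (n * h) := Finset.sum_le_sum fun t _ => key t
    _ = _ := by simp

lemma shift_iter (m : ℕ) (j : ℕ) (x : ℕ → Fin m) (i : ℕ) : ((shift m)^[j] x) i = x (i + j) := by
  induction j generalizing x i with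
  | zero => rfl
  | succ j ih =>
    rw [Function.iterate_succ_apply, ih]
    exact congrArg x (by omega)

/-- Bowen balls of radius one are cylinders. -/
lemma mem_bowenBall_one {m n : ℕ} {x y : ℕ → Fin m} :
    y ∈ bowenBall (shift m) n 1 x → ∀ i < n, y i = x i := by
  intro h i hi
  have h1 := h i hi
  have := PiNat.apply_eq_of_dist_lt (n := 0) (by simpa using h1) (le_refl 0)
  simp only [shift_iter, zero_add] at this
  exact this.symm

lemma mem_bowenBall_of {m n L : ℕ} {x y : ℕ → Fin m} {ε : ℝ} (hL : (1 / 2 : ℝ) ^ L < ε)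
    (h : ∀ i < n + L, y i = x i) : y ∈ bowenBall (shift m) n ε x := by
  intro j hj
  refine lt_of_le_of_lt ?_ hL
  rw [← PiNat.mem_cylinder_iff_dist_le]
  intro i hi
  rw [shift_iter, shift_iter, h _ (by omega)]

lemma bowenHn_le_of {X ι : Type*} [MetricSpace X] [Countable ι] [Infinite ι] (T : X → X)
    (Z : Set X) (s ε : ℝ) (n : ℕ) (c : ι → X × ℕ)
    (hc : Z ⊆ ⋃ i, bowenBall T (c i).2 ε (c i).1) (hn : ∀ i, n ≤ (c i).2) :
    bowenHn T Z s ε n ≤ ∑' i, ENNReal.ofReal (Real.exp (-(s * ((c i).2 : ℝ)))) := by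
  obtain ⟨_⟩ := nonempty_denumerable ι
  let e := (Denumerable.eqv ι).symm
  rw [← e.tsum_eq]
  unfold bowenHn
  refine iInf_le_of_le (c ∘ e) (iInf_le_of_le ?_ (iInf_le_of_le ?_ le_rfl))
  · intro x hx
    obtain ⟨i, hi⟩ := Set.mem_iUnion.1 (hc hx)
    exact Set.mem_iUnion.2 ⟨e.symm i, by simpa using hi⟩
  · intro i
    exact hn _

lemma upper_bound {m : ℕ} (hm : 0 < m) (Z : Set (ℕ → Fin m)) (h : ℝ) (h0 : 0 ≤ h)
    (hZ : ∀ x ∈ Z, ∀ N, ∃ n ≥ N,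
      ∑ j, Real.negMulLog (wfreq (fun i : Fin n => x (i + 1)) j) ≤ h) :
    htop (shift m) Z ≤ ENNReal.ofReal h := by
  classical
  have : NeZero m := ⟨hm.ne'⟩
  refine iSup₂_le fun ε hε => ?_
  obtain ⟨L, hL⟩ := exists_pow_lt_of_lt_one hε (by norm_num : (1 / 2 : ℝ) < 1)
  refine ENNReal.le_of_forall_pos_le_add fun δ hδ _ => ?_
  let s : ℝ≥0 := h.toNNReal + δ
  have hs : (s : ℝ) = h + δ := by simp [s, h0]
  have hsE : (s : ℝ≥0∞) = ENNReal.ofReal h + δ := by simp [s, ENNReal.ofReal]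
  rw [← hsE]
  refine iInf₂_le s ?_
  let W : ℕ → Type := fun n =>
    Fin m × {u : Fin n → Fin m // ∑ j, Real.negMulLog (wfreq u j) ≤ h} × (Fin L → Fin m)
  let ext : ∀ n, W n → ℕ → Fin m := fun n w i =>
    match i with
    | 0 => w.1
    | i + 1 => if h : i < n then w.2.1.1 ⟨i, h⟩ else
        if h' : i - n < L then w.2.2 ⟨i - n, h'⟩ else 0
  let f : ℕ → ℝ := fun n => (m : ℝ) * m ^ L * (((n : ℝ) + 1) ^ m * Real.exp (-(δ * n)))
  have hf0 : ∀ n, 0 ≤ f n := fun n => by positivity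
  have hf : Summable f := by
    apply Summable.mul_left
    have h1 := Real.summable_pow_mul_exp_neg_nat_mul m (show (0 : ℝ) < δ by exact_mod_cast hδ)
    have h2 := ((summable_nat_add_iff 1).2 h1).mul_left (Real.exp δ)
    refine h2.congr fun n => ?_
    push_cast
    rw [mul_left_comm, ← Real.exp_add]
    congr 2
    ring
  have hcard : ∀ n : ℕ, (Fintype.card (W n) : ℝ) * Real.exp (-(s * n)) ≤ f n := by
    intro n
    have h1 := card_words_le (m := m) (n := n) h
    have h2 : (Fintype.card (W n) : ℝ) = m * m ^ L *
        Fintype.card {u : Fin n → Fin m // ∑ j, Real.negMulLog (wfreq u j) ≤ h} := by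
      simp only [W, Fintype.card_prod, Fintype.card_fin, Fintype.card_fun]
      push_cast
      ring
    rw [h2]
    calc _ ≤ (m : ℝ) * m ^ L * (((n : ℝ) + 1) ^ m * Real.exp (n * h)) * Real.exp (-(s * n)) := by
          gcongr
      _ = f n := by
          simp only [f]
          rw [mul_assoc, mul_assoc (((n : ℝ) + 1) ^ m), ← Real.exp_add, hs]
          congr 3
          ring_nf
  have hbound : ∀ N n, n ≤ N → bowenHn (shift m) Z s ε n ≤ ∑' k, ENNReal.ofReal (f (k + N)) := by
    intro N n hnN
    let c : (Σ k, W (k + N)) → (ℕ → Fin m) × ℕ := fun w => (ext _ w.2, w.1 + N)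
    have hne : ∀ k, Nonempty (W k) := by
      intro k
      refine ⟨(0, ⟨fun _ => 0, ?_⟩, fun _ => 0)⟩
      refine le_trans (le_of_eq (Finset.sum_eq_zero fun j _ => ?_)) h0
      by_cases hj : (0 : Fin m) = j
      · rcases Nat.eq_zero_or_pos k with rfl | hk
        · simp [wfreq]
        · have : (k : ℝ) ≠ 0 := by exact_mod_cast hk.ne'
          simp [wfreq, hj, this]
      · simp [wfreq, hj]
    have : Infinite (Σ k, W (k + N)) :=
      Infinite.of_injective (fun k => (⟨k, (hne (k + N)).some⟩ : Σ k, W (k + N)))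
        fun a b hab => congrArg Sigma.fst hab
    refine (bowenHn_le_of (shift m) Z s ε n c ?_ ?_).trans ?_
    · intro x hx
      obtain ⟨k, hk, hxk⟩ := hZ x hx N
      obtain ⟨k, rfl⟩ := Nat.exists_eq_add_of_le' hk
      refine Set.mem_iUnion.2 ⟨⟨k, (x 0, ⟨fun i => x (i + 1), hxk⟩,
        fun i => x (k + N + i + 1))⟩, ?_⟩
      refine mem_bowenBall_of hL fun i hi => ?_
      simp only [c] at hi ⊢
      rcases i with _ | i
      · rfl
      · simp only [ext]
        split_ifs with h1 h2
        · rfl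
        · congr 1
          omega
        · omega
    · intro w
      simp only [c]
      omega
    · rw [ENNReal.tsum_sigma']
      refine ENNReal.tsum_le_tsum fun k => ?_
      rw [tsum_fintype]
      simp only [c, Finset.sum_const, nsmul_eq_mul, Finset.card_univ]
      rw [← ENNReal.ofReal_natCast, ← ENNReal.ofReal_mul (by positivity)]
      exact ENNReal.ofReal_le_ofReal (hcard _)
  have hsum : ∑' k, ENNReal.ofReal (f k) ≠ ∞ := by
    rw [← ENNReal.ofReal_tsum_of_nonneg hf0 hf]
    exact ENNReal.ofReal_ne_top
  have htend := ENNReal.tendsto_sum_nat_add _ hsum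
  unfold bowenH
  refine le_antisymm (iSup_le fun n => ?_) bot_le
  exact ge_of_tendsto htend (eventually_atTop.2 ⟨n, fun N hN => hbound N n hN⟩)

/-- One-letter distribution. -/
noncomputable def letterMeasure {m : ℕ} (p : Fin m → ℝ) : Measure (Fin m) :=
  ∑ j, ENNReal.ofReal (p j) • Measure.dirac j

lemma letterMeasure_singleton {m : ℕ} (p : Fin m → ℝ) (j : Fin m) :
    letterMeasure p {j} = ENNReal.ofReal (p j) := by
  classical
  simp only [letterMeasure, Measure.finsetSum_apply, Measure.smul_apply, smul_eq_mul]
  rw [Finset.sum_eq_single j]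
  · simp
  · intro b _ hb
    simp [hb]
  · simp

lemma letterMeasure_prob {m : ℕ} (p : Fin m → ℝ) (h0 : ∀ j, 0 ≤ p j) (h1 : ∑ j, p j = 1) :
    IsProbabilityMeasure (letterMeasure p) := by
  constructor
  simp only [letterMeasure, Measure.finsetSum_apply, Measure.smul_apply, smul_eq_mul,
    measure_univ, mul_one]
  rw [← ENNReal.ofReal_sum_of_nonneg (fun j _ => h0 j), h1, ENNReal.ofReal_one]

lemma integral_letterMeasure {m : ℕ} (p : Fin m → ℝ) (h0 : ∀ j, 0 ≤ p j) (h1 : ∑ j, p j = 1)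
    (f : Fin m → ℝ) : ∫ j, f j ∂(letterMeasure p) = ∑ j, f j * p j := by
  have := letterMeasure_prob p h0 h1
  rw [integral_fintype Integrable.of_finite]
  refine Finset.sum_congr rfl fun j _ => ?_
  rw [measureReal_def, letterMeasure_singleton, ENNReal.toReal_ofReal (h0 j), smul_eq_mul, mul_comm]

lemma slln {m : ℕ} (p : Fin m → ℝ) (h0 : ∀ j, 0 ≤ p j) (h1 : ∑ j, p j = 1)
    [IsProbabilityMeasure (letterMeasure p)] (f : Fin m → ℝ) (a : ℕ) :
    ∀ᵐ x ∂(Measure.infinitePi fun _ : ℕ => letterMeasure p),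
      Tendsto (fun n : ℕ => (∑ i : Fin n, f (x (i + a))) / n) atTop (𝓝 (∑ j, f j * p j)) := by
  have hf : Measurable f := measurable_of_countable f
  have hmp : ∀ i : ℕ, MeasurePreserving (Function.eval i)
      (Measure.infinitePi fun _ : ℕ => letterMeasure p) (letterMeasure p) :=
    fun i => measurePreserving_eval_infinitePi (fun _ : ℕ => letterMeasure p) i
  have hind := ProbabilityTheory.iIndepFun_infinitePi (P := fun _ : ℕ => letterMeasure p)
    (X := fun _ => f) (fun _ => hf)
  have key := ProbabilityTheory.strong_law_ae_real
    (μ := Measure.infinitePi fun _ : ℕ => letterMeasure p)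
    (fun i x => f (x (i + a))) ?_ ?_ ?_
  · filter_upwards [key] with x hx
    have hint : ∫ x, f (x (0 + a)) ∂(Measure.infinitePi fun _ : ℕ => letterMeasure p) =
        ∑ j, f j * p j := by
      have h2 := integral_map (hmp (0 + a)).measurable.aemeasurable
        (μ := Measure.infinitePi fun _ : ℕ => letterMeasure p) (f := f) hf.aestronglyMeasurable
      rw [(hmp (0 + a)).map_eq, integral_letterMeasure p h0 h1 f] at h2
      exact h2.symm
    rw [hint] at hx
    refine hx.congr fun n => ?_
    rw [Finset.sum_range]
  · exact ((hmp (0 + a)).integrable_comp hf.aestronglyMeasurable).2 Integrable.of_finite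
  · intro i j hij
    exact hind.indepFun (by omega)
  · intro i
    have hm' : ∀ i : ℕ, Measurable (fun x : ℕ → Fin m => f (x i)) :=
      fun i => hf.comp (measurable_pi_apply i)
    refine ⟨(hm' _).aemeasurable, (hm' _).aemeasurable, ?_⟩
    have : ∀ i, Measure.map (fun x : ℕ → Fin m => f (x i))
        (Measure.infinitePi fun _ : ℕ => letterMeasure p) = Measure.map f (letterMeasure p) := by
      intro i
      have h2 := Measure.map_map (μ := Measure.infinitePi fun _ : ℕ => letterMeasure p)
        hf (hmp i).measurable
      rw [(hmp i).map_eq] at h2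
      exact h2.symm
    rw [this, this]

lemma measure_cylinder_le {m : ℕ} (p : Fin m → ℝ) (h0 : ∀ j, 0 ≤ p j)
    [IsProbabilityMeasure (letterMeasure p)] (x : ℕ → Fin m) (n : ℕ) :
    (Measure.infinitePi fun _ : ℕ => letterMeasure p) {y | ∀ i < n, y i = x i} ≤
      ENNReal.ofReal (Real.exp (∑ i : Fin n, Real.log (p (x (i + 0))))) := by
  have : {y : ℕ → Fin m | ∀ i < n, y i = x i} = Set.pi (Finset.range n : Set ℕ) fun i => {x i} := by
    ext y; simp
  rw [this, Measure.infinitePi_pi _ (fun i _ => measurableSet_singleton _)]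
  simp only [letterMeasure_singleton]
  rw [← ENNReal.ofReal_prod_of_nonneg (fun i _ => h0 _), Real.exp_sum]
  apply ENNReal.ofReal_le_ofReal
  rw [Finset.prod_range]
  refine Finset.prod_le_prod (fun i _ => h0 _) fun i _ => ?_
  exact Real.le_exp_log _

lemma lower_bound {m : ℕ} (p : Fin m → ℝ) (h0 : ∀ j, 0 ≤ p j) (h1 : ∑ j, p j = 1)
    (Z : Set (ℕ → Fin m))
    (hZ : ∀ x : ℕ → Fin m, (∀ j, Tendsto (fun n : ℕ => wfreq (fun i : Fin n => x (i + 1)) j)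
      atTop (𝓝 (p j))) → x ∈ Z) :
    ENNReal.ofReal (∑ j, Real.negMulLog (p j)) ≤ htop (shift m) Z := by
  classical
  have := letterMeasure_prob p h0 h1
  set μ := Measure.infinitePi fun _ : ℕ => letterMeasure p with hμ
  refine le_trans ?_ (le_iSup₂ (f := fun (ε : ℝ) (_ : 0 < ε) => bowenEnt (shift m) Z ε) 1 one_pos)
  refine le_iInf₂ fun s hs => ?_
  by_contra hcon
  push Not at hcon
  have hsH : (s : ℝ) < ∑ j, Real.negMulLog (p j) := by
    rw [← ENNReal.ofReal_coe_nnreal] at hcon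
    exact (ENNReal.ofReal_lt_ofReal_iff_of_nonneg s.2).1 hcon
  -- the good sets
  let G : ℕ → Set (ℕ → Fin m) := fun N => {x | x ∈ Z ∧
    ∀ n ≥ N, μ {y | ∀ i < n, y i = x i} ≤ ENNReal.ofReal (Real.exp (-(s * (n : ℝ))))}
  have hae : ∀ᵐ x ∂μ, x ∈ ⋃ N, G N := by
    have ha := slln p h0 h1 (fun j => Real.log (p j)) 0
    have hb : ∀ᵐ x ∂μ, ∀ j : Fin m, Tendsto (fun n : ℕ =>
        (∑ i : Fin n, (fun k => if k = j then (1 : ℝ) else 0) (x (i + 1))) / n) atTop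
        (𝓝 (∑ k, (fun k => if k = j then (1 : ℝ) else 0) k * p k)) :=
      ae_all_iff.2 fun j => slln p h0 h1 (fun k => if k = j then (1 : ℝ) else 0) 1
    filter_upwards [ha, hb] with x hxa hxb
    have hxZ : x ∈ Z := by
      apply hZ
      intro j
      have := hxb j
      simp only [ite_mul, one_mul, zero_mul, Finset.sum_ite_eq', Finset.mem_univ, if_true] at this
      refine this.congr fun n => ?_
      simp [wfreq]
    have hlim : ∑ j, Real.log (p j) * p j < -(s : ℝ) := by
      have : ∑ j, Real.log (p j) * p j = - ∑ j, Real.negMulLog (p j) := by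
        rw [← Finset.sum_neg_distrib]
        exact Finset.sum_congr rfl fun j _ => by simp [Real.negMulLog, mul_comm]
      rw [this]
      linarith
    obtain ⟨N, hN⟩ := eventually_atTop.1 ((hxa.eventually (gt_mem_nhds hlim)).and
      (eventually_gt_atTop 0))
    refine Set.mem_iUnion.2 ⟨N, hxZ, fun n hn => ?_⟩
    refine (measure_cylinder_le p h0 x n).trans ?_
    apply ENNReal.ofReal_le_ofReal
    apply Real.exp_le_exp.2
    obtain ⟨hn1, hn2⟩ := hN n hn
    have hn3 : (0 : ℝ) < n := by exact_mod_cast hn2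
    rw [div_lt_iff₀ hn3] at hn1
    linarith
  obtain ⟨N, hN⟩ : ∃ N, μ (G N) ≠ 0 := by
    by_contra hall
    push Not at hall
    have h2 : μ (⋃ N, G N) = 0 := measure_iUnion_null hall
    have h3 : μ (⋃ N, G N)ᶜ = 0 := hae
    have h4 : μ Set.univ ≤ 0 := by
      rw [← Set.union_compl_self (⋃ N, G N)]
      exact (measure_union_le _ _).trans (by rw [h2, h3]; simp)
    simp at h4
  have hle : μ (G N) ≤ bowenHn (shift m) Z s 1 N := by
    refine le_iInf fun c => le_iInf fun hc => le_iInf fun hn => ?_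
    have hsub : G N ⊆ ⋃ i, (G N ∩ bowenBall (shift m) (c i).2 1 (c i).1) := by
      intro x hx
      obtain ⟨i, hi⟩ := Set.mem_iUnion.1 (hc hx.1)
      exact Set.mem_iUnion.2 ⟨i, hx, hi⟩
    refine (measure_mono hsub).trans ((measure_iUnion_le _).trans
      (ENNReal.tsum_le_tsum fun i => ?_))
    rcases (G N ∩ bowenBall (shift m) (c i).2 1 (c i).1).eq_empty_or_nonempty with he | ⟨x, hx⟩
    · rw [he]; simp
    · refine le_trans (measure_mono ?_) (hx.1.2 _ (hn i))
      intro y hy k hk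
      rw [mem_bowenBall_one hy.2 k hk, mem_bowenBall_one hx.2 k hk]
  apply hN
  have h5 : bowenHn (shift m) Z s 1 N ≤ 0 := by
    rw [← hs]
    exact le_iSup (fun n => bowenHn (shift m) Z s 1 n) N
  exact le_antisymm (hle.trans h5) bot_le

lemma Vstat_eq {m r : ℕ} (φ : Fin r → Fin m → ℝ) (n : ℕ) (x : ℕ → Fin m) :
    Vstat (shift m) (fun x : Fin r → (ℕ → Fin m) => ∏ k : Fin r, φ k (x k 0)) n x =
      ∏ k, ∑ j, φ k j * wfreq (fun i : Fin n => x (i + 1)) j := by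
  simp only [← sum_comp_div]
  rw [Finset.prod_div_distrib]
  unfold Vstat
  simp only [shift_iter, zero_add, Finset.prod_const, Finset.card_univ, Fintype.card_fin]
  congr 1
  rw [Finset.prod_univ_sum, Fintype.piFinset_univ]

lemma integral_part {m r : ℕ} (φ : Fin r → Fin m → ℝ) (p : Fin m → ℝ) (h0 : ∀ j, 0 ≤ p j)
    (μ : Measure (ℕ → Fin m)) [IsProbabilityMeasure μ]
    (hμ : ∀ w : List (Fin m),
          μ (cyl w) = ENNReal.ofReal (∏ i : Fin w.length, p (w.get i))) :
    ∫ y : Fin r → (ℕ → Fin m), ∏ k : Fin r, φ k (y k 0) ∂(Measure.pi fun _ : Fin r => μ) =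
      ∏ k : Fin r, ∑ j : Fin m, φ k j * p j := by
  rw [integral_fintype_prod_eq_prod (fun k (x : ℕ → Fin m) => φ k (x 0))]
  refine Finset.prod_congr rfl fun k _ => ?_
  have hme : Measurable (fun x : ℕ → Fin m => x 0) := measurable_pi_apply 0
  have := Measure.isProbabilityMeasure_map (μ := μ) hme.aemeasurable
  rw [← integral_map (φ := fun x : ℕ → Fin m => x 0) (f := φ k) hme.aemeasurable
    (measurable_of_countable _).aestronglyMeasurable, integral_fintype Integrable.of_finite]
  refine Finset.sum_congr rfl fun j _ => ?_
  rw [measureReal_def, Measure.map_apply hme (measurableSet_singleton j), smul_eq_mul, mul_comm]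
  congr 1
  have : (fun x : ℕ → Fin m => x 0) ⁻¹' {j} = cyl [j] := by
    ext x
    simp [cyl]
  rw [this, hμ]
  simp [h0]

lemma exists_limit {m r : ℕ} (φ : Fin r → Fin m → ℝ) (α : ℝ) (x : ℕ → Fin m)
    (hx : Tendsto (fun n : ℕ => ∏ k : Fin r, ∑ j, φ k j * wfreq (fun i : Fin n => x (i + 1)) j)
      atTop (𝓝 α)) (h : ℝ)
    (hfreq : ∃ᶠ n : ℕ in atTop, h ≤ ∑ j, Real.negMulLog (wfreq (fun i : Fin n => x (i + 1)) j)) :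
    ∃ p : Fin m → ℝ, (∀ j, 0 ≤ p j) ∧ ∑ j, p j = 1 ∧ (∏ k : Fin r, ∑ j, φ k j * p j) = α ∧
      h ≤ ∑ j, Real.negMulLog (p j) := by
  obtain ⟨θ, hθ, hθ'⟩ := extraction_of_frequently_atTop
    (hfreq.and_eventually (eventually_gt_atTop 0))
  obtain ⟨p, hp, ψ, hψ, hlim⟩ := (isCompact_stdSimplex ℝ (Fin m)).tendsto_subseq
    (x := fun n => wfreq (fun i : Fin (θ n) => x (i + 1)))
    (fun n => ⟨fun j => wfreq_nonneg _ _, wfreq_sum (hθ' n).2.ne' _⟩)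
  refine ⟨p, hp.1, hp.2, ?_, ?_⟩
  · have hc : Continuous (fun p : Fin m → ℝ => ∏ k : Fin r, ∑ j, φ k j * p j) := by fun_prop
    exact tendsto_nhds_unique ((hc.tendsto p).comp hlim)
      (hx.comp (hθ.tendsto_atTop.comp hψ.tendsto_atTop))
  · have hc : Continuous (fun p : Fin m → ℝ => ∑ j, Real.negMulLog (p j)) :=
      continuous_finsetSum _ fun j _ => Real.continuous_negMulLog.comp (continuous_apply j)
    exact ge_of_tendsto ((hc.tendsto p).comp hlim) (Eventually.of_forall fun n => (hθ' _).1)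

/-- (Theorem 5.3) On the full shift `(Σ_m, σ)`, for a kernel
`Φ(x⁽¹⁾, …, x⁽ʳ⁾) = φ_1(x⁽¹⁾_1) ⋯ φ_r(x⁽ʳ⁾_1)` depending on first coordinates:
for any probability vector `p` and Bernoulli measure `μ_p`,
`A(p) = ∫ Φ d(μ_p)^{⊗r} = ∏_k ∑_j φ_k(j) p_j`; and for every `α` with `E_Φ(α) ≠ ∅`,
`h_top(E_Φ(α)) = max { H_1(p) : A(p) = α }` with `H_1(p) = -∑_j p_j log p_j`. -/
theorem htop_Eset_eq_max_entropy_bernoulli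
    (m : ℕ) (hm : 2 ≤ m) (r : ℕ) (hr : 1 ≤ r)
    (φ : Fin r → Fin m → ℝ)
    (Φ : (Fin r → (ℕ → Fin m)) → ℝ)
    (hΦ : Φ = fun x => ∏ k : Fin r, φ k (x k 0)) :
    (∀ p : Fin m → ℝ, (∀ j, 0 ≤ p j) → ∑ j, p j = 1 →
      ∀ μ : Measure (ℕ → Fin m), IsProbabilityMeasure μ →
        (∀ w : List (Fin m),
          μ (cyl w) = ENNReal.ofReal (∏ i : Fin w.length, p (w.get i))) →
        ∫ y, Φ y ∂(Measure.pi fun _ : Fin r => μ) =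
          ∏ k : Fin r, ∑ j : Fin m, φ k j * p j) ∧
    (∀ α : ℝ, (Eset (shift m) Φ α).Nonempty →
      ∃ p : Fin m → ℝ, (∀ j, 0 ≤ p j) ∧ ∑ j, p j = 1 ∧
        (∏ k : Fin r, ∑ j : Fin m, φ k j * p j) = α ∧
        htop (shift m) (Eset (shift m) Φ α) =
          ENNReal.ofReal (∑ j : Fin m, Real.negMulLog (p j)) ∧
        ∀ q : Fin m → ℝ, (∀ j, 0 ≤ q j) → ∑ j, q j = 1 →
          (∏ k : Fin r, ∑ j : Fin m, φ k j * q j) = α →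
          ∑ j : Fin m, Real.negMulLog (q j) ≤ ∑ j : Fin m, Real.negMulLog (p j)) := by
  subst hΦ
  refine ⟨fun p h0 _ μ hμ hcyl => integral_part φ p h0 μ hcyl, fun α hne => ?_⟩
  have hE : ∀ x, x ∈ Eset (shift m) (fun x : Fin r → (ℕ → Fin m) => ∏ k : Fin r, φ k (x k 0)) α ↔
      Tendsto (fun n : ℕ => ∏ k : Fin r, ∑ j, φ k j * wfreq (fun i : Fin n => x (i + 1)) j)
        atTop (𝓝 α) := by
    intro x
    simp only [Eset, Set.mem_ofPred_eq, Vstat_eq]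
  have hc : Continuous (fun p : Fin m → ℝ => ∏ k : Fin r, ∑ j, φ k j * p j) := by fun_prop
  have hcH : Continuous (fun p : Fin m → ℝ => ∑ j, Real.negMulLog (p j)) :=
    continuous_finsetSum _ fun j _ => Real.continuous_negMulLog.comp (continuous_apply j)
  have hle1 : ∀ p : Fin m → ℝ, (∀ j, 0 ≤ p j) → ∑ j, p j = 1 →
      0 ≤ ∑ j, Real.negMulLog (p j) := fun p h0 h1 =>
    Finset.sum_nonneg fun j _ => Real.negMulLog_nonneg (h0 j)
      (h1 ▸ Finset.single_le_sum (fun i _ => h0 i) (Finset.mem_univ j))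
  have hK : IsCompact (stdSimplex ℝ (Fin m) ∩
      {p : Fin m → ℝ | ∏ k : Fin r, ∑ j, φ k j * p j = α}) :=
    (isCompact_stdSimplex ℝ (Fin m)).inter_right (isClosed_eq hc continuous_const)
  have hKne : (stdSimplex ℝ (Fin m) ∩
      {p : Fin m → ℝ | ∏ k : Fin r, ∑ j, φ k j * p j = α}).Nonempty := by
    obtain ⟨x, hx⟩ := hne
    obtain ⟨p, h0, h1, h2, -⟩ := exists_limit φ α x ((hE x).1 hx) 0
      ((eventually_gt_atTop 0).mono fun n hn =>
        hle1 _ (fun j => wfreq_nonneg _ _) (wfreq_sum hn.ne' _)).frequently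
    exact ⟨p, ⟨h0, h1⟩, h2⟩
  obtain ⟨p, ⟨⟨h0, h1⟩, h2⟩, hmax⟩ := hK.exists_isMaxOn hKne hcH.continuousOn
  have hmax' : ∀ q : Fin m → ℝ, (∀ j, 0 ≤ q j) → ∑ j, q j = 1 →
          (∏ k : Fin r, ∑ j : Fin m, φ k j * q j) = α →
          ∑ j : Fin m, Real.negMulLog (q j) ≤ ∑ j : Fin m, Real.negMulLog (p j) :=
    fun q a b c => hmax ⟨⟨a, b⟩, c⟩
  refine ⟨p, h0, h1, h2, le_antisymm ?_ ?_, hmax'⟩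
  · refine ENNReal.le_of_forall_pos_le_add fun δ hδ _ => ?_
    rw [← ENNReal.ofReal_coe_nnreal, ← ENNReal.ofReal_add (hle1 p h0 h1) δ.coe_nonneg]
    have hδ' : (0 : ℝ) < δ := by exact_mod_cast hδ
    refine upper_bound (by omega) _ _ (add_nonneg (hle1 p h0 h1) δ.coe_nonneg) fun x hx N => ?_
    by_contra hcon
    push Not at hcon
    obtain ⟨q, a, b, c, d⟩ := exists_limit φ α x ((hE x).1 hx)
      (∑ j, Real.negMulLog (p j) + δ)
      (eventually_atTop.2 ⟨N, fun n hn => (hcon n hn).le⟩).frequently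
    have := hmax' q a b c
    linarith
  · refine lower_bound p h0 h1 _ fun x hx => ?_
    rw [hE]
    have h3 : Tendsto (fun n : ℕ => wfreq (fun i : Fin n => x (i + 1))) atTop (𝓝 p) :=
      tendsto_pi_nhds.2 hx
    have h4 := (hc.tendsto p).comp h3
    have h5 : ∏ k : Fin r, ∑ j, φ k j * p j = α := h2
    simp only [h5] at h4
    exact h4

end Shift
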